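/- Let M be a positive real number, and let α = [0; a₁, a₂, …] and β = [0; b₁, b₂, …] be real numbers whose partial quotients are all at most M. Suppose there exists a positive integer n such that aᵢ = bᵢ for all i = 1, …, n and a_{n+1} ≠ b_{n+1}. Then |α − β| ≥ 1/((M+2)³ · q_n²), where q_n is the denominator of the n-th convergent of α. -/

import Mathlib

open Filter Topology

/-- Distance from a real number to the nearest integer. -/
noncomputable def nint (x : ℝ) : ℝ := |x - round x|

/-- A real number is badly approximable: `inf_{q ≥ 1} q·‖qα‖ > 0`. -/
def IsBad (α : ℝ) : Prop :=
  0 < ⨅ q : ℕ+, ((q : ℕ) : ℝ) * nint (((q : ℕ) : ℝ) * α)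

/-- Denominators (continuants) of the continued fraction `[0; a 1, a 2, …]`:
`q 0 = 1`, `q 1 = a 1`, `q (j+2) = a (j+2) * q (j+1) + q j`. -/
def cfQ (a : ℕ → ℕ) : ℕ → ℕ
  | 0 => 1
  | 1 => a 1
  | n + 2 => a (n + 2) * cfQ a (n + 1) + cfQ a n

/-- Numerators of the continued fraction `[0; a 1, a 2, …]`. -/
def cfP (a : ℕ → ℕ) : ℕ → ℕ
  | 0 => 0
  | 1 => 1
  | n + 2 => a (n + 2) * cfP a (n + 1) + cfP a n

/-- `a` (indexed from `1`) is the sequence of partial quotients of the continued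
fraction expansion of `α`, i.e. `α = [0; a 1, a 2, …]`. -/
def IsCF (a : ℕ → ℕ) (α : ℝ) : Prop :=
  (∀ i, 1 ≤ i → 1 ≤ a i) ∧
    Tendsto (fun n => (cfP a n : ℝ) / (cfQ a n)) atTop (nhds α)

/-- The finite continued fraction `[a k; a (k+1), …, a (k+m)]`. -/
noncomputable def cfTail (a : ℕ → ℕ) : ℕ → ℕ → ℝ
  | k, 0 => a k
  | k, m + 1 => a k + 1 / cfTail a (k + 1) m

theorem cfTail_pos {a : ℕ → ℕ} (ha : ∀ i, 1 ≤ i → 1 ≤ a i) (k m : ℕ) (hk : 1 ≤ k) :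
    0 < cfTail a k m := by
  have h : (0 : ℝ) < a k := by exact_mod_cast ha k hk
  induction m generalizing k with
  | zero => exact h
  | succ m ih =>
    have := ih (k + 1) (by lia) (by exact_mod_cast ha (k + 1) (by lia))
    rw [cfTail]
    positivity

theorem le_cfTail {a : ℕ → ℕ} (ha : ∀ i, 1 ≤ i → 1 ≤ a i) (k m : ℕ) :
    (a k : ℝ) ≤ cfTail a k m := by
  cases m with
  | zero => exact le_rfl
  | succ m =>
    have := cfTail_pos ha (k + 1) m (by lia)
    rw [cfTail, le_add_iff_nonneg_right]
    positivity

theorem cfTail_le_add_one {a : ℕ → ℕ} (ha : ∀ i, 1 ≤ i → 1 ≤ a i) (k m : ℕ) :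
    cfTail a k m ≤ a k + 1 := by
  cases m with
  | zero => simp [cfTail]
  | succ m =>
    have h₁ : (1 : ℝ) ≤ a (k + 1) := by exact_mod_cast ha (k + 1) (by lia)
    have h₂ := h₁.trans (le_cfTail ha (k + 1) m)
    rw [cfTail]
    gcongr
    exact div_le_one_of_le₀ h₂ (by positivity)

theorem cfTail_add_two_le {a : ℕ → ℕ} (ha : ∀ i, 1 ≤ i → 1 ≤ a i) {M : ℝ} (hM : 0 < M)
    (haM : ∀ i, 1 ≤ i → (a i : ℝ) ≤ M) (k m : ℕ) :
    cfTail a k (m + 2) ≤ a k + 1 - 1 / (M + 2) := by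
  have h₁ : (1 : ℝ) ≤ a (k + 1) := by exact_mod_cast ha (k + 1) (by lia)
  have h₂ : 1 / (M + 1) ≤ 1 / cfTail a (k + 2) m :=
    one_div_le_one_div_of_le (cfTail_pos ha (k + 2) m (by lia))
      ((cfTail_le_add_one ha (k + 2) m).trans (by linarith [haM (k + 2) (by lia)]))
  have h₃ : 1 + 1 / (M + 1) ≤ cfTail a (k + 1) (m + 1) := by
    rw [cfTail]
    exact add_le_add h₁ h₂
  have h₄ := one_div_le_one_div_of_le (by positivity) h₃
  have h₅ : 1 / (1 + 1 / (M + 1)) = 1 - 1 / (M + 2) := by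
    field_simp
    ring
  rw [cfTail]
  linarith

theorem cfQ_pos {a : ℕ → ℕ} (ha : ∀ i, 1 ≤ i → 1 ≤ a i) (n : ℕ) : 0 < cfQ a n := by
  induction n using Nat.strong_induction_on with
  | _ n ih =>
    match n with
    | 0 => simp [cfQ]
    | 1 => exact ha 1 le_rfl
    | n + 2 =>
      rw [cfQ]
      have := ih n (by lia)
      positivity

theorem cfQ_le_succ {a : ℕ → ℕ} (ha : ∀ i, 1 ≤ i → 1 ≤ a i) (n : ℕ) :
    cfQ a n ≤ cfQ a (n + 1) := by
  cases n with
  | zero => exact ha 1 le_rfl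
  | succ n =>
    rw [cfQ]
    exact le_add_right (Nat.le_mul_of_pos_left _ (ha (n + 2) (by lia)))

theorem abs_cfP_mul_cfQ_sub (a : ℕ → ℕ) (n : ℕ) :
    |(cfP a (n + 1) : ℝ) * cfQ a n - cfP a n * cfQ a (n + 1)| = 1 := by
  induction n with
  | zero => simp [cfP, cfQ]
  | succ n ih =>
    rw [← ih, abs_sub_comm]
    simp only [cfP, cfQ]
    push_cast
    congr 1
    ring

theorem cfP_div_cfQ_eq {a : ℕ → ℕ} (ha : ∀ i, 1 ≤ i → 1 ≤ a i) (n m : ℕ) :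
    (cfP a (n + 2 + m) : ℝ) / cfQ a (n + 2 + m) =
      (cfP a (n + 1) * cfTail a (n + 2) m + cfP a n) /
        (cfQ a (n + 1) * cfTail a (n + 2) m + cfQ a n) := by
  induction m generalizing n with
  | zero =>
    simp only [cfP, cfQ, cfTail]
    push_cast
    ring_nf
  | succ m ih =>
    have hT := cfTail_pos ha (n + 3) m (by lia)
    rw [show n + 2 + (m + 1) = n + 1 + 2 + m by ring, ih (n + 1),
      ← mul_div_mul_right (cfP a (n + 1) * cfTail a (n + 2) (m + 1) + cfP a n) _ hT.ne']
    simp only [cfP, cfQ, cfTail]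
    push_cast
    congr 1 <;> field_simp <;> ring

theorem cfP_cfQ_congr {a b : ℕ → ℕ} (n : ℕ) (hab : ∀ i, 1 ≤ i → i ≤ n → a i = b i) :
    cfP a n = cfP b n ∧ cfQ a n = cfQ b n := by
  induction n using Nat.strong_induction_on with
  | _ n ih =>
    match n with
    | 0 => simp [cfP, cfQ]
    | 1 => simp [cfP, cfQ, hab 1 le_rfl le_rfl]
    | n + 2 =>
      obtain ⟨hp₀, hq₀⟩ := ih n (by lia) fun i h₁ h₂ => hab i h₁ (by lia)
      obtain ⟨hp₁, hq₁⟩ := ih (n + 1) (by lia) fun i h₁ h₂ => hab i h₁ (by lia)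
      simp [cfP, cfQ, hp₀, hq₀, hp₁, hq₁, hab (n + 2) (by lia) le_rfl]

theorem one_div_le_abs_cfTail_sub {a b : ℕ → ℕ} (ha : ∀ i, 1 ≤ i → 1 ≤ a i)
    (hb : ∀ i, 1 ≤ i → 1 ≤ b i) {M : ℝ} (hM : 0 < M) (haM : ∀ i, 1 ≤ i → (a i : ℝ) ≤ M)
    (hbM : ∀ i, 1 ≤ i → (b i : ℝ) ≤ M) (k m : ℕ) (hne : a k ≠ b k) :
    1 / (M + 2) ≤ |cfTail a k (m + 2) - cfTail b k (m + 2)| := by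
  wlog hlt : b k < a k generalizing a b
  · rw [abs_sub_comm]
    exact this hb ha hbM haM hne.symm (by lia)
  have h₁ := le_cfTail ha k (m + 2)
  have h₂ := cfTail_add_two_le hb hM hbM k m
  have h₃ : (b k : ℝ) + 1 ≤ a k := by exact_mod_cast hlt
  exact le_trans (by linarith) (le_abs_self _)

/-- The separation of the images of two points under a Möbius map of determinant `±1`. -/
theorem one_div_le_abs_mobius_sub {p p' q q' x y M : ℝ} (hdet : |p * q' - p' * q| = 1)
    (hq : 0 < q) (hq' : 0 ≤ q') (hqq : q' ≤ q) (hM : 0 < M) (hx : 0 < x) (hy : 0 < y)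
    (hxM : x ≤ M + 1) (hyM : y ≤ M + 1) (hxy : 1 / (M + 2) ≤ |x - y|) :
    1 / ((M + 2) ^ 3 * q ^ 2) ≤ |(p * x + p') / (q * x + q') - (p * y + p') / (q * y + q')| := by
  have hX : 0 < q * x + q' := by positivity
  have hY : 0 < q * y + q' := by positivity
  have bound {z : ℝ} (hz : z ≤ M + 1) : q * z + q' ≤ q * (M + 2) := by
    nlinarith [mul_le_mul_of_nonneg_left hz hq.le]
  have hdiff : (p * x + p') / (q * x + q') - (p * y + p') / (q * y + q') =
      (p * q' - p' * q) * (x - y) / ((q * x + q') * (q * y + q')) := by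
    rw [div_sub_div _ _ hX.ne' hY.ne']
    ring
  rw [hdiff, abs_div, abs_mul, hdet, one_mul, abs_of_pos (mul_pos hX hY)]
  calc 1 / ((M + 2) ^ 3 * q ^ 2) = 1 / (M + 2) / (q * (M + 2) * (q * (M + 2))) := by
        field_simp
    _ ≤ |x - y| / ((q * x + q') * (q * y + q')) := by
        gcongr
        · exact bound hxM
        · exact bound hyM

/-- Lemma 5.  Let `M > 0`, and let `α = [0; a 1, a 2, …]`
and `β = [0; b 1, b 2, …]` have all partial quotients at most `M`.  If the
first `n` partial quotients of `α` and `β` agree but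
`a (n+1) ≠ b (n+1)`, then `|α - β| ≥ 1/((M+2)³·(q n)²)`, where `q n` is the
denominator of the `n`-th convergent of `α`. -/
theorem abs_sub_ge_of_ne_partial_quotient
    (M : ℝ) (hM : 0 < M)
    (α β : ℝ) (a b : ℕ → ℕ) (hα : IsCF a α) (hβ : IsCF b β)
    (haM : ∀ i, 1 ≤ i → (a i : ℝ) ≤ M) (hbM : ∀ i, 1 ≤ i → (b i : ℝ) ≤ M)
    (n : ℕ) (hn : 1 ≤ n) (hab : ∀ i, 1 ≤ i → i ≤ n → a i = b i)
    (hne : a (n + 1) ≠ b (n + 1)) :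
    1 / ((M + 2) ^ 3 * (cfQ a n : ℝ) ^ 2) ≤ |α - β| := by
  obtain ⟨ha, hα⟩ := hα
  obtain ⟨hb, hβ⟩ := hβ
  obtain ⟨k, rfl⟩ : ∃ k, n = k + 1 := ⟨n - 1, by lia⟩
  refine ge_of_tendsto (hα.sub hβ).abs ?_
  filter_upwards [eventually_ge_atTop (k + 4)] with N hN
  obtain ⟨m, rfl⟩ : ∃ m, N = k + 2 + (m + 2) := ⟨N - (k + 4), by lia⟩
  obtain ⟨hp₀, hq₀⟩ := cfP_cfQ_congr k fun i h₁ h₂ => hab i h₁ (by lia)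
  obtain ⟨hp₁, hq₁⟩ := cfP_cfQ_congr (k + 1) hab
  rw [cfP_div_cfQ_eq ha, cfP_div_cfQ_eq hb, ← hp₀, ← hq₀, ← hp₁, ← hq₁]
  exact one_div_le_abs_mobius_sub (abs_cfP_mul_cfQ_sub a k) (by exact_mod_cast cfQ_pos ha _)
    (by positivity) (by exact_mod_cast cfQ_le_succ ha k) hM
    (cfTail_pos ha _ _ (by lia)) (cfTail_pos hb _ _ (by lia))
    ((cfTail_le_add_one ha _ _).trans (by linarith [haM (k + 2) (by lia)]))
    ((cfTail_le_add_one hb _ _).trans (by linarith [hbM (k + 2) (by lia)]))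
    (one_div_le_abs_cfTail_sub ha hb hM haM hbM _ m hne)
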